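/- (Hochschild–Kostant–Rosenberg, affine cohomological case.) Let k be a field of characteristic zero and let R be a smooth commutative k-algebra (formally smooth and of finite type over k), regarded as a module over R ⊗_k R via the multiplication map. Then for every i ≥ 0 there is an isomorphism of k-modules Ext^i_{R⊗_k R}(R, R) ≅ ⋀^i_R Der_k(R, R), where Der_k(R, R) is the R-module of k-linear derivations of R and ⋀^i_R denotes the i-th exterior power over R. -/

import Mathlib

open CategoryTheory TensorProduct

namespace HKR
open ModuleCat

/-- adjunction as linear equiv -/
noncomputable def adjEquiv {A B : Type} [CommRing A] [CommRing B] (f : A →+* B)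
    (X : ModuleCat.{0} A) (N : ModuleCat.{0} B) :
    ((restrictScalars f).obj (ModuleCat.of B ((extendScalars f).obj X ⟶ N)) : ModuleCat A) ≃ₗ[A]
      (X ⟶ (restrictScalars f).obj N) :=
    { toFun := fun g => (extendRestrictScalarsAdj f).homEquiv X N g
      invFun := fun g => ((extendRestrictScalarsAdj f).homEquiv X N).symm g
      left_inv := fun g => Equiv.symm_apply_apply _ _
      right_inv := fun g => Equiv.apply_symm_apply _ _
      map_add' := fun a b => by
        ext x; rfl
      map_smul' := fun r a => by
        ext x; rfl }

lemma ext_change {A B : Type} [CommRing A] [CommRing B] (f : A →+* B) (hf : f.Flat)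
    (M : ModuleCat.{0} A) (N : ModuleCat.{0} B) (n : ℕ) :
    Nonempty ((restrictScalars f).obj
        (((Ext B (ModuleCat B) n).obj (Opposite.op ((extendScalars f).obj M))).obj N) ≅
      ((Ext A (ModuleCat A) n).obj (Opposite.op M)).obj ((restrictScalars f).obj N)) := by
  have h1 := preservesFiniteLimits_extendScalars_of_flat hf
  have : (extendScalars f).PreservesProjectiveObjects :=
    Functor.preservesProjectiveObjects_of_adjunction_of_preservesEpimorphisms
      (extendRestrictScalarsAdj f)
  have : (extendScalars f).Additive := (extendRestrictScalarsAdj f).left_adjoint_additive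
  have : (extendScalars f).PreservesHomology := inferInstance
  let P : ProjectiveResolution M := projectiveResolution M
  let Q := (extendScalars f).mapProjectiveResolution P
  let e : ((restrictScalars f).mapHomologicalComplex _).obj (Q.complex.linearYonedaObj B N) ≅
      P.complex.linearYonedaObj A ((restrictScalars f).obj N) :=
    HomologicalComplex.Hom.isoOfComponents (fun i => (adjEquiv f (P.complex.X i) N).toModuleIso) (by
      intro i j hij
      refine ModuleCat.hom_ext (LinearMap.ext fun g => ?_)
      exact ((extendRestrictScalarsAdj f).homEquiv_naturality_left (P.complex.d j i) g).symm)
  refine ⟨(restrictScalars f).mapIso (Q.isoExt n N) ≪≫ ?_ ≪≫ (P.isoExt n _).symm⟩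
  exact (ShortComplex.mapHomologyIso ((Q.complex.linearYonedaObj B N).sc n)
    (restrictScalars f)).symm ≪≫ HomologicalComplex.homologyMapIso e n
end HKR

open CategoryTheory TensorProduct

namespace HKR
section kosz
variable {R : Type} [CommRing R] {M : Type} [AddCommGroup M] [Module R M]

lemma hps (n : ℕ) : ⋀[R]^(n+1) M = LinearMap.range (ExteriorAlgebra.ι R (M := M)) * ⋀[R]^n M :=
  pow_succ' _ _

lemma hp0 : ⋀[R]^0 M = 1 := pow_zero _

/-- contraction on exterior powers -/
lemma contract_mem (φ : Module.Dual R M) (n : ℕ) (x : ExteriorAlgebra R M)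
    (hx : x ∈ ⋀[R]^(n+1) M) :
    CliffordAlgebra.contractLeft (Q := (0 : QuadraticForm R M)) φ x ∈ ⋀[R]^n M := by
  induction n generalizing x with
  | zero =>
    obtain ⟨m, rfl⟩ : x ∈ LinearMap.range (ExteriorAlgebra.ι R (M := M)) := by
      simpa using hx
    have := CliffordAlgebra.contractLeft_ι (Q := (0 : QuadraticForm R M)) φ m
    erw [this]
    simp only [pow_zero]
    exact Submodule.mem_one.2 ⟨_, rfl⟩
  | succ n ih =>
    rw [hps] at hx
    refine Submodule.mul_induction_on hx ?_ ?_
    · rintro _ ⟨m, rfl⟩ y hy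
      have := CliffordAlgebra.contractLeft_ι_mul (Q := (0 : QuadraticForm R M)) (d := φ) m y
      erw [this]
      refine Submodule.sub_mem _ (Submodule.smul_mem _ _ hy) ?_
      rw [hps]
      exact Submodule.mul_mem_mul ⟨m, rfl⟩ (ih y hy)
    · intro x y hx hy
      rw [map_add]
      exact Submodule.add_mem _ hx hy

noncomputable def cc (φ : Module.Dual R M) (n : ℕ) : ⋀[R]^(n+1) M →ₗ[R] ⋀[R]^n M :=
  (CliffordAlgebra.contractLeft (Q := (0 : QuadraticForm R M)) φ).restrict (contract_mem φ n)

noncomputable def ww (n : ℕ) : M →ₗ[R] ⋀[R]^n M →ₗ[R] ⋀[R]^(n+1) M :=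
  LinearMap.mk₂ R (fun m x => ⟨ExteriorAlgebra.ι R m * x.1, by
      rw [hps]; exact Submodule.mul_mem_mul ⟨m, rfl⟩ x.2⟩)
    (fun _ _ _ => by ext; simp [add_mul]) (fun _ _ _ => by ext; simp)
    (fun _ _ _ => by ext; simp [mul_add]) (fun _ _ _ => by ext; simp)

lemma cc_ww (φ : Module.Dual R M) (m : M) (n : ℕ) (x : ⋀[R]^(n+1) M) :
    cc φ (n+1) (ww (n+1) m x) + ww n m (cc φ n x) = φ m • x := by
  ext
  have := CliffordAlgebra.contractLeft_ι_mul (Q := (0 : QuadraticForm R M)) (d := φ) m x.1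
  change CliffordAlgebra.contractLeft (Q := (0 : QuadraticForm R M)) φ (ExteriorAlgebra.ι R m * x.1) +
    ExteriorAlgebra.ι R m * CliffordAlgebra.contractLeft (Q := (0 : QuadraticForm R M)) φ x.1 = φ m • x.1
  erw [this]
  exact sub_add_cancel _ _

lemma cc_cc (φ ψ : Module.Dual R M) (n : ℕ) (x : ⋀[R]^(n+2) M) :
    cc φ n (cc ψ (n+1) x) = - cc ψ n (cc φ (n+1) x) := by
  ext
  exact CliffordAlgebra.contractLeft_comm (Q := (0 : QuadraticForm R M)) (d := φ) (d' := ψ) x.1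

/-- dual basis -/
structure DB (R M : Type) [CommRing R] [AddCommGroup M] [Module R M] where
  N : ℕ
  e : Fin N → M
  φ : Fin N → Module.Dual R M
  h : ∀ m, ∑ i, φ i m • e i = m

lemma exists_DB [Module.Finite R M] [Module.Projective R M] : Nonempty (DB R M) := by
  obtain ⟨n, f, hf⟩ := Module.Finite.exists_fin' R M
  obtain ⟨g, hg⟩ := Module.projective_lifting_property f LinearMap.id hf
  refine ⟨⟨n, fun i => f (Pi.single i 1), fun i => LinearMap.proj i ∘ₗ g, fun m => ?_⟩⟩
  simp only [LinearMap.comp_apply, LinearMap.proj_apply, ← map_smul, ← map_sum]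
  conv_rhs => rw [← LinearMap.id_apply (R := R) m, ← hg]
  simp only [LinearMap.comp_apply]
  congr 1
  ext j
  simp [Finset.sum_apply, Pi.single_apply]

lemma euler_ext (b : DB R M) (n : ℕ) (x : ExteriorAlgebra R M) (hx : x ∈ ⋀[R]^n M) :
    ∑ i, ExteriorAlgebra.ι R (b.e i) *
      CliffordAlgebra.contractLeft (Q := (0 : QuadraticForm R M)) (b.φ i) x = (n : R) • x := by
  induction n generalizing x with
  | zero =>
    rw [hp0, Submodule.mem_one] at hx
    obtain ⟨r, rfl⟩ := hx
    refine (Finset.sum_eq_zero fun i _ => ?_).trans (by simp)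
    have := CliffordAlgebra.contractLeft_algebraMap (Q := (0 : QuadraticForm R M)) (d := b.φ i) r
    erw [this]
    exact mul_zero _
  | succ n ih =>
    rw [hps] at hx
    refine Submodule.mul_induction_on hx ?_ ?_
    · rintro _ ⟨m, rfl⟩ y hy
      have h1 : ∀ i, ExteriorAlgebra.ι R (b.e i) *
        CliffordAlgebra.contractLeft (Q := (0 : QuadraticForm R M)) (b.φ i) (ExteriorAlgebra.ι R m * y)
        = ExteriorAlgebra.ι R (b.φ i m • b.e i) * y + ExteriorAlgebra.ι R m * (ExteriorAlgebra.ι R (b.e i) *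
        CliffordAlgebra.contractLeft (Q := (0 : QuadraticForm R M)) (b.φ i) y) := by
        intro i
        have := CliffordAlgebra.contractLeft_ι_mul (Q := (0 : QuadraticForm R M)) (d := b.φ i) m y
        erw [this]
        have h2 : ExteriorAlgebra.ι R (b.e i) * ExteriorAlgebra.ι R m =
          - (ExteriorAlgebra.ι R m * ExteriorAlgebra.ι R (b.e i)) :=
          eq_neg_of_add_eq_zero_left (ExteriorAlgebra.ι_add_mul_swap _ _)
        refine (mul_sub _ _ _).trans ?_
        rw [map_smul, smul_mul_assoc, sub_eq_add_neg]
        congr 1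
        · exact mul_smul_comm _ _ _
        · refine (congrArg _ (mul_assoc _ _ _).symm).trans ?_
          refine (congrArg (fun z => -(z * _)) h2).trans ?_
          rw [neg_mul, neg_neg, mul_assoc]
      rw [Finset.sum_congr rfl fun i _ => h1 i, Finset.sum_add_distrib, ← Finset.sum_mul,
        ← Finset.mul_sum, ih y hy, ← map_sum, b.h]
      simp [add_smul, add_comm]
    · intro x y hx hy
      simp only [map_add, mul_add, Finset.sum_add_distrib, smul_add, hx, hy]

lemma euler_ext' (b : DB R M) (n : ℕ) (x : ⋀[R]^(n+1) M) :
    ∑ i, ww n (b.e i) (cc (b.φ i) n x) = ((n+1 : ℕ) : R) • x := by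
  ext
  rw [AddSubmonoidClass.coe_finsetSum]
  exact euler_ext b (n+1) x.1 x.2

abbrev S (R M : Type) [CommRing R] [AddCommGroup M] [Module R M] := SymmetricAlgebra R M

/-- derivation of the symmetric algebra -/
lemma exists_der (L : M →ₗ[R] S R M) : ∃ D : Derivation R (S R M) (S R M),
    ∀ m, D (SymmetricAlgebra.ι R M m) = L m := by
  let a : S R M →ₐ[R] TrivSqZeroExt (S R M) (S R M) := SymmetricAlgebra.lift
    ((TrivSqZeroExt.inlAlgHom R (S R M) (S R M)).toLinearMap ∘ₗ SymmetricAlgebra.ι R M +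
      (TrivSqZeroExt.inrHom (S R M) (S R M)).restrictScalars R ∘ₗ L)
  have ha : ∀ s, (a s).fst = s := by
    intro s
    have : (TrivSqZeroExt.fstHom R (S R M) (S R M)).comp a = AlgHom.id R _ := by
      apply SymmetricAlgebra.algHom_ext
      ext m
      simp [a]
    exact DFunLike.congr_fun this s
  refine ⟨Derivation.mk' ((TrivSqZeroExt.sndHom (S R M) (S R M)).restrictScalars R ∘ₗ a.toLinearMap) ?_, ?_⟩
  · intro s t
    simp [ha, mul_comm]
  · intro m
    simp [a]

noncomputable def der (L : M →ₗ[R] S R M) : Derivation R (S R M) (S R M) := (exists_der L).choose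
lemma der_ι (L : M →ₗ[R] S R M) (m : M) : der L (SymmetricAlgebra.ι R M m) = L m :=
  (exists_der L).choose_spec m

lemma span_eig : Submodule.span R {s : S R M | ∃ p : ℕ, der (SymmetricAlgebra.ι R M) s = p • s} = ⊤ := by
  rw [eq_top_iff]
  intro s _
  induction s using SymmetricAlgebra.induction with
  | algebraMap r => exact Submodule.subset_span ⟨0, by simp⟩
  | ι x => exact Submodule.subset_span ⟨1, by simp [der_ι]⟩
  | add a b ha hb => exact Submodule.add_mem _ (ha trivial) (hb trivial)
  | mul a b ha hb =>
    have := Submodule.mul_mem_mul (ha trivial) (hb trivial)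
    rw [Submodule.span_mul_span] at this
    refine Submodule.span_mono ?_ this
    rintro _ ⟨x, ⟨p, hp⟩, y, ⟨q, hq⟩, rfl⟩
    refine ⟨q + p, ?_⟩
    simp only [Derivation.leibniz, hp, hq, smul_eq_mul]
    simp only [nsmul_eq_mul]; push_cast; ring

noncomputable def pd (φ : Module.Dual R M) : Derivation R (S R M) (S R M) := der (Algebra.linearMap R (S R M) ∘ₗ φ)

lemma pd_mul (φ : Module.Dual R M) (m : M) (s : S R M) : pd φ (SymmetricAlgebra.ι R M m * s) =
    φ m • s + SymmetricAlgebra.ι R M m * pd φ s := by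
  simp [pd, der_ι, Derivation.leibniz, Algebra.smul_def]; ring

lemma euler_sym (b : DB R M) (s : S R M) :
    ∑ j, SymmetricAlgebra.ι R M (b.e j) * pd (b.φ j) s = der (SymmetricAlgebra.ι R M) s := by
  let D : Derivation R (S R M) (S R M) := ∑ j, SymmetricAlgebra.ι R M (b.e j) • pd (b.φ j)
  have hD : ∀ t, D t = ∑ j, SymmetricAlgebra.ι R M (b.e j) * pd (b.φ j) t := fun t => by
    change Derivation.coeFnAddMonoidHom D t = _
    simp only [D, map_sum, Finset.sum_apply]
    rfl
  rw [← hD]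
  induction s using SymmetricAlgebra.induction with
  | algebraMap r => simp
  | ι x =>
    rw [hD, der_ι]
    conv_rhs => rw [← b.h x, map_sum]
    refine Finset.sum_congr rfl fun i _ => ?_
    simp [pd, der_ι, Algebra.smul_def, mul_comm]
  | add a b ha hb => simp [ha, hb]
  | mul a b ha hb => simp [Derivation.leibniz, ha, hb]

abbrev KK (R M : Type) [CommRing R] [AddCommGroup M] [Module R M] (n : ℕ) := S R M ⊗[R] ⋀[R]^n M

noncomputable def kd (b : DB R M) (n : ℕ) : KK R M (n+1) →ₗ[S R M] KK R M n :=
  ∑ i, SymmetricAlgebra.ι R M (b.e i) • (cc (b.φ i) n).baseChange (S R M)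

lemma kd_tmul (b : DB R M) (n : ℕ) (s : S R M) (x : ⋀[R]^(n+1) M) :
    kd b n (s ⊗ₜ x) = ∑ i, (SymmetricAlgebra.ι R M (b.e i) * s) ⊗ₜ cc (b.φ i) n x := by
  simp [kd, TensorProduct.smul_tmul']

noncomputable def kδ (b : DB R M) (n : ℕ) : KK R M n →ₗ[R] KK R M (n+1) :=
  ∑ j, TensorProduct.map (pd (b.φ j)).toLinearMap (ww n (b.e j))

lemma kδ_tmul (b : DB R M) (n : ℕ) (s : S R M) (x : ⋀[R]^n M) :
    kδ b n (s ⊗ₜ x) = ∑ j, pd (b.φ j) s ⊗ₜ ww n (b.e j) x := by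
  simp [kδ]

lemma homot (b : DB R M) (n : ℕ) (s : S R M) (x : ⋀[R]^(n+1) M) :
    kd b (n+1) (kδ b (n+1) (s ⊗ₜ x)) + kδ b n (kd b n (s ⊗ₜ x)) =
      der (SymmetricAlgebra.ι R M) s ⊗ₜ x + ((n+1 : ℕ) : R) • (s ⊗ₜ x) := by
  simp only [kd_tmul, kδ_tmul, map_sum]
  rw [Finset.sum_comm, ← Finset.sum_add_distrib]
  have h1 : ∀ i, (∑ j, (SymmetricAlgebra.ι R M (b.e i) * pd (b.φ j) s) ⊗ₜ[R] cc (b.φ i) (n+1) (ww (n+1) (b.e j) x)) +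
     ∑ j, pd (b.φ j) (SymmetricAlgebra.ι R M (b.e i) * s) ⊗ₜ[R] ww n (b.e j) (cc (b.φ i) n x) =
     ∑ j, ((SymmetricAlgebra.ι R M (b.φ i (b.e j) • b.e i) * pd (b.φ j) s) ⊗ₜ[R] x +
       s ⊗ₜ[R] ww n (b.φ j (b.e i) • b.e j) (cc (b.φ i) n x)) := by
    intro i
    rw [← Finset.sum_add_distrib]
    refine Finset.sum_congr rfl fun j _ => ?_
    rw [pd_mul, add_tmul, eq_sub_of_add_eq (cc_ww (b.φ i) (b.e j) n x), tmul_sub]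
    simp only [map_smul, LinearMap.smul_apply, tmul_smul, smul_tmul', smul_mul_assoc]
    abel
  rw [Finset.sum_congr rfl fun i _ => h1 i]
  simp only [Finset.sum_add_distrib]
  congr 1
  · rw [Finset.sum_comm]
    simp only [← sum_tmul, ← Finset.sum_mul, ← map_sum, b.h]
    rw [euler_sym]
  · simp only [← tmul_sum, ← LinearMap.sum_apply, ← map_sum, b.h]
    rw [euler_ext', tmul_smul]

lemma kd_kd (b : DB R M) [Algebra ℚ R] (n : ℕ) (x : KK R M (n+2)) : kd b n (kd b (n+1) x) = 0 := by
  induction x using TensorProduct.induction_on with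
  | zero => simp
  | add x y hx hy => simp [hx, hy]
  | tmul s x =>
    have h2 : (2:R) • kd b n (kd b (n+1) (s ⊗ₜ x)) = 0 := by
      rw [two_smul]
      simp only [kd_tmul, map_sum]
      conv_lhs => enter [2]; rw [Finset.sum_comm]
      rw [← Finset.sum_add_distrib]
      refine Finset.sum_eq_zero fun i _ => ?_
      rw [← Finset.sum_add_distrib]
      refine Finset.sum_eq_zero fun j _ => ?_
      rw [cc_cc, tmul_neg, ← mul_assoc, ← mul_assoc, mul_comm (SymmetricAlgebra.ι R M (b.e i))]
      exact neg_add_cancel _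
    have h3 : IsUnit (2:R) := by
      have := (IsUnit.mk0 (2:ℚ) two_ne_zero).map (algebraMap ℚ R)
      simpa only [map_ofNat] using this
    exact (h3.smul_eq_zero).1 h2
open Polynomial in
lemma kexact (b : DB R M) [Algebra ℚ R] (n : ℕ) (x : KK R M (n+1)) (hx : kd b n x = 0) :
    ∃ y, kd b (n+1) y = x := by
  let E : Module.End R (KK R M (n+1)) := (kd b (n+1)).restrictScalars R ∘ₗ kδ b (n+1) +
    kδ b n ∘ₗ (kd b n).restrictScalars R
  have hE : ∀ s x, E (s ⊗ₜ x) = der (SymmetricAlgebra.ι R M) s ⊗ₜ x + ((n+1 : ℕ) : R) • (s ⊗ₜ x) :=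
    fun s x => homot b n s x
  have h1 : ∃ q : R[X], IsUnit (q.coeff 0) ∧ aeval E q x = 0 := by
    clear hx
    induction x using TensorProduct.induction_on with
    | zero => exact ⟨1, by simp⟩
    | add x y hx hy =>
      obtain ⟨p, hp, hpx⟩ := hx
      obtain ⟨q, hq, hqx⟩ := hy
      refine ⟨p * q, by rw [mul_coeff_zero]; exact hp.mul hq, ?_⟩
      rw [map_add]
      nth_rw 1 [mul_comm]
      simp [map_mul, hpx, hqx]
    | tmul s x =>
      have hs : s ∈ Submodule.span R {s : S R M | ∃ p : ℕ, der (SymmetricAlgebra.ι R M) s = p • s} := by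
        rw [span_eig]; trivial
      induction hs using Submodule.span_induction with
      | mem s hs =>
        obtain ⟨p, hp⟩ := hs
        refine ⟨X - C ((p + (n+1) : ℕ) : R), ?_, ?_⟩
        · simp only [coeff_sub, coeff_X_zero, coeff_C_zero, zero_sub, IsUnit.neg_iff]
          have : IsUnit ((p + (n+1) : ℕ) : ℚ) := IsUnit.mk0 _ (by positivity)
          simpa using this.map (algebraMap ℚ R)
        · simp only [map_sub, aeval_X, aeval_C, LinearMap.sub_apply, hE, hp]
          simp only [Module.algebraMap_end_apply, Nat.cast_add, add_smul, Nat.cast_smul_eq_nsmul, smul_tmul']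
          simp
      | zero => exact ⟨1, by simp⟩
      | add s t _ _ hx hy =>
        obtain ⟨p, hp, hpx⟩ := hx
        obtain ⟨q, hq, hqx⟩ := hy
        refine ⟨p * q, by rw [mul_coeff_zero]; exact hp.mul hq, ?_⟩
        rw [add_tmul, map_add]
        nth_rw 1 [mul_comm]
        simp [map_mul, hpx, hqx]
      | smul a s _ h =>
        obtain ⟨p, hp, hpx⟩ := h
        exact ⟨p, hp, by rw [← smul_tmul', map_smul, hpx, smul_zero]⟩
  obtain ⟨q, hq, hqx⟩ := h1
  have hker : ∀ z, kd b n z = 0 → E z = kd b (n+1) (kδ b (n+1) z) := by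
    intro z hz
    simp [E, hz]
  have hker2 : ∀ (r : R[X]) z, kd b n z = 0 → kd b n (aeval E r z) = 0 := by
    intro r
    induction r using Polynomial.induction_on' with
    | add p q hp hq => intro z hz; simp [hp z hz, hq z hz]
    | monomial i a =>
      induction i with
      | zero => intro z hz; simp [Module.algebraMap_end_apply, hz, LinearMap.map_smul_of_tower]
      | succ i ih =>
        intro z hz
        rw [← monomial_mul_X, map_mul, aeval_X, Module.End.mul_apply]
        apply ih
        rw [hker z hz, kd_kd]
  obtain ⟨u, hu⟩ := hq
  have hq2 : q = X * q.divX + C (q.coeff 0) := by rw [mul_comm, divX_mul_X_add]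
  rw [hq2, map_add, map_mul, aeval_X, aeval_C, LinearMap.add_apply, Module.End.mul_apply,
    hker _ (hker2 _ _ hx), Module.algebraMap_end_apply] at hqx
  refine ⟨-((↑u⁻¹ : R) • kδ b (n+1) (aeval E q.divX x)), ?_⟩
  rw [map_neg, LinearMap.map_smul_of_tower, eq_neg_of_add_eq_zero_left hqx, ← hu, smul_neg, neg_neg, smul_smul]
  simp
end kosz
end HKR

open CategoryTheory TensorProduct

namespace HKR
open ModuleCat

lemma ext_of_minimal {S : Type} [CommRing S] (X : ℕ → ModuleCat.{0} S) (d : ∀ n, X (n+1) ⟶ X n)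
    (hX : ∀ n, Projective (X n))
    (sq : ∀ n, d (n+1) ≫ d n = 0) (Z Y : ModuleCat.{0} S) (ε : X 0 ⟶ Z) (hε : d 0 ≫ ε = 0)
    (hs : Function.Surjective ε) (h0 : ∀ x, ε x = 0 → ∃ y, d 0 y = x)
    (h1 : ∀ n x, d n x = 0 → ∃ y, d (n+1) y = x)
    (hz : ∀ n (g : X n ⟶ Y), d n ≫ g = 0) (n : ℕ) :
    Nonempty (((Ext S (ModuleCat S) n).obj (Opposite.op Z)).obj Y ≅ ModuleCat.of S (X n ⟶ Y)) := by
  let K : ChainComplex (ModuleCat S) ℕ := ChainComplex.of X d sq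
  have hd : ∀ n, K.d (n+1) n = d n := fun n => ChainComplex.of_d X d n
  have hε' : K.d 1 0 ≫ ε = 0 := by rw [hd 0]; exact hε
  let π := (K.toSingle₀Equiv Z).symm ⟨ε, hε'⟩
  have hπ : π.f 0 = ε := ChainComplex.toSingle₀Equiv_symm_apply_f_zero _ _
  have hq : QuasiIso π := ⟨by
    intro i
    cases i with
    | zero =>
      rw [ChainComplex.quasiIsoAt₀_iff, ShortComplex.quasiIso_iff_of_zeros']
      · refine ⟨?_, ?_⟩
        · rw [ShortComplex.moduleCat_exact_iff]
          intro x hx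
          obtain ⟨y, hy⟩ := h0 x (by
            rw [← hπ]; exact hx)
          refine ⟨y, ?_⟩
          rw [← hd 0] at hy
          exact hy
        · change Epi (π.f 0)
          rw [hπ]
          exact (ModuleCat.epi_iff_surjective ε).2 hs
      · change K.d 0 0 = 0
        exact K.shape _ _ (by simp)
      · rfl
      · rfl
    | succ i =>
      rw [quasiIsoAt_iff_exactAt' _ _ (ChainComplex.exactAt_succ_single_obj _ _),
        HomologicalComplex.exactAt_iff' _ (i+2) (i+1) i (by simp) (by simp),
        ShortComplex.moduleCat_exact_iff]
      intro x hx
      obtain ⟨y, hy⟩ := h1 i x (by rw [← hd i]; exact hx)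
      refine ⟨y, ?_⟩
      rw [← hd (i+1)] at hy
      exact hy⟩
  let P : ProjectiveResolution Z := { complex := K, projective := hX, π := π, quasiIso := hq }
  let C := P.complex.linearYonedaObj S Y
  have hC : ∀ i j, C.d i j = 0 := by
    intro i j
    refine ModuleCat.hom_ext (LinearMap.ext fun g => ?_)
    change K.d j i ≫ g = 0
    by_cases h : i + 1 = j
    · subst h
      rw [hd]; exact hz i g
    · rw [K.shape _ _ (by simpa using h)]
      exact Limits.zero_comp
  exact ⟨P.isoExt n Y ≪≫ (ShortComplex.HomologyData.ofZeros (C.sc n) (hC _ _) (hC _ _)).left.homologyIso⟩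

section
variable {R : Type} [CommRing R] {M : Type} [AddCommGroup M] [Module R M]

lemma proj_ext [Module.Finite R M] [Module.Projective R M] (n : ℕ) :
    Module.Projective R (⋀[R]^n M) := by
  obtain ⟨m, f, hf⟩ := Module.Finite.exists_fin' R M
  obtain ⟨g, hg⟩ := Module.projective_lifting_property f LinearMap.id hf
  refine Module.Projective.of_split (exteriorPower.map n g) (exteriorPower.map n f) ?_
  rw [← exteriorPower.map_comp, hg, exteriorPower.map_id]

lemma cc_ww0 (φ : Module.Dual R M) (m : M) (x : ⋀[R]^0 M) :
    cc φ 0 (ww 0 m x) = φ m • x := by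
  ext
  have := CliffordAlgebra.contractLeft_ι_mul (Q := (0 : QuadraticForm R M)) (d := φ) m x.1
  change CliffordAlgebra.contractLeft (Q := (0 : QuadraticForm R M)) φ (ExteriorAlgebra.ι R m * x.1)
     = φ m • x.1
  erw [this]
  obtain ⟨x, hx⟩ := x
  obtain ⟨r, rfl⟩ := Submodule.mem_one.1 (hp0 (R := R) (M := M) ▸ hx)
  have h2 := CliffordAlgebra.contractLeft_algebraMap (Q := (0 : QuadraticForm R M)) (d := φ) r
  erw [h2]
  exact (congrArg _ (mul_zero _)).trans (sub_zero _)

lemma koszul_ext [Algebra ℚ R] [Module.Finite R M] [Module.Projective R M] (n : ℕ) :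
    let aug : S R M →+* R := (SymmetricAlgebra.algebraMapInv (R := R) (M := M)).toRingHom
    let N := (restrictScalars aug).obj (ModuleCat.of R R)
    Nonempty (((Ext (S R M) (ModuleCat (S R M)) n).obj (Opposite.op N)).obj N ≅
      (restrictScalars aug).obj (ModuleCat.of R (⋀[R]^n M →ₗ[R] R))) := by
  intro aug N
  obtain ⟨b⟩ := exists_DB (R := R) (M := M)
  let _ : Module (S R M) R := Module.compHom R aug
  have hsm : ∀ (s : S R M) (r : R), s • r = aug s * r := fun _ _ => rfl
  have haug : ∀ r : R, aug (algebraMap R (S R M) r) = r := fun r =>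
    SymmetricAlgebra.algebraMap_leftInverse M r
  have haugι : ∀ m : M, aug (SymmetricAlgebra.ι R M m) = 0 := fun m =>
    SymmetricAlgebra.algebraMapInv_ι m
  have : IsScalarTower R (S R M) R := ⟨fun a s r => by
    rw [hsm, hsm, Algebra.smul_def, map_mul, haug, smul_eq_mul, mul_assoc]⟩
  have := fun n => proj_ext (R := R) (M := M) n
  have hp : ∀ n, Projective (ModuleCat.of (S R M) (KK R M n)) := fun n =>
    (IsProjective.iff_projective _).1 inferInstance
  let ε : KK R M 0 →ₗ[S R M] R := (exteriorPower.zeroEquiv (R := R) (M := M)).toLinearMap.liftBaseChange (S R M)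
  have hzero : ∀ n (g : KK R M n →ₗ[S R M] R) x, g (kd b n x) = 0 := by
    intro n g x
    induction x using TensorProduct.induction_on with
    | zero => simp
    | add x y hx hy => simp [hx, hy]
    | tmul s x =>
      rw [kd_tmul, map_sum]
      refine Finset.sum_eq_zero fun i _ => ?_
      rw [← smul_eq_mul, ← smul_tmul', map_smul, hsm, haugι, zero_mul]
  obtain ⟨e⟩ := ext_of_minimal (fun n => ModuleCat.of (S R M) (KK R M n))
    (fun n => ModuleCat.ofHom (kd b n)) hp (fun n => by
      exact ModuleCat.hom_ext (LinearMap.ext fun x => kd_kd b n x)) N N (ModuleCat.ofHom ε) (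
      ModuleCat.hom_ext (LinearMap.ext fun x => hzero 0 ε x))
      (by
        intro r
        refine ⟨1 ⊗ₜ (exteriorPower.zeroEquiv (R := R) (M := M)).symm r, ?_⟩
        change ε _ = _
        simp only [ε, LinearMap.liftBaseChange_tmul, one_smul]
        exact (exteriorPower.zeroEquiv R M).apply_symm_apply r)
      (by
        intro x hx
        change ε x = 0 at hx
        change ∃ y, kd b 0 y = x
        let z1 := (exteriorPower.zeroEquiv R M).symm 1
        have hx' : ∃ s : S R M, x = s ⊗ₜ z1 := by
          clear hx
          induction x using TensorProduct.induction_on with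
          | zero => exact ⟨0, by simp⟩
          | add x y hx hy =>
            obtain ⟨s, rfl⟩ := hx
            obtain ⟨t, rfl⟩ := hy
            exact ⟨s + t, by rw [add_tmul]⟩
          | tmul s x =>
            refine ⟨exteriorPower.zeroEquiv R M x • s, ?_⟩
            rw [smul_tmul, ← map_smul, smul_eq_mul, mul_one,
              LinearEquiv.symm_apply_apply]
        obtain ⟨s, rfl⟩ := hx'
        have hs : aug s = 0 := by
          rw [LinearMap.liftBaseChange_tmul, hsm] at hx
          have h2 : (exteriorPower.zeroEquiv R M) z1 = 1 := LinearEquiv.apply_symm_apply _ _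
          rw [LinearEquiv.coe_coe, h2, mul_one] at hx
          exact hx
        have key : ∀ s : S R M, (s - algebraMap R (S R M) (aug s)) ⊗ₜ z1 ∈ LinearMap.range (kd b 0) := by
          intro s
          induction s using SymmetricAlgebra.induction with
          | algebraMap r => simp [haug]
          | ι m =>
            refine ⟨1 ⊗ₜ ww 0 m z1, ?_⟩
            rw [kd_tmul, haugι, map_zero, sub_zero]
            conv_rhs => rw [← b.h m, map_sum, sum_tmul]
            refine Finset.sum_congr rfl fun i _ => ?_
            rw [cc_ww0, mul_one, map_smul, tmul_smul, smul_tmul']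
          | add s t hs ht =>
            have := Submodule.add_mem _ hs ht
            rw [← add_tmul] at this
            convert this using 2
            rw [map_add, map_add]; ring
          | mul s t hs ht =>
            have := Submodule.add_mem _ (Submodule.smul_mem _ t hs)
              (Submodule.smul_mem _ (algebraMap R (S R M) (aug s)) ht)
            rw [smul_tmul', smul_tmul', ← add_tmul] at this
            convert this using 2
            rw [map_mul, map_mul, smul_eq_mul, smul_eq_mul]; ring
        have := key s
        rw [hs, map_zero, sub_zero] at this
        exact this)
      (fun n x hx => kexact b n x hx)
      (fun n g => by
        exact ModuleCat.hom_ext (LinearMap.ext fun x => hzero n g.hom x)) n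
  let e2 : (⋀[R]^n M →ₗ[R] R) ≃ₗ[S R M] (KK R M n →ₗ[S R M] R) := LinearMap.liftBaseChangeEquiv (S R M)
  let e3 : ((restrictScalars aug).obj (ModuleCat.of R (⋀[R]^n M →ₗ[R] R)) : ModuleCat (S R M)) ≃ₗ[S R M]
      (ModuleCat.of (S R M) (KK R M n) ⟶ N) :=
    { toFun := fun g => ModuleCat.ofHom (e2 g)
      invFun := fun g => e2.symm g.hom
      left_inv := fun g => e2.symm_apply_apply g
      right_inv := fun g => by
        ext1; exact e2.apply_symm_apply g.hom
      map_add' := fun a b => by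
        ext1; exact e2.map_add a b
      map_smul' := fun r a => by
        ext1; exact e2.map_smul r a }
  exact ⟨e ≪≫ e3.toModuleIso.symm⟩

end
end HKR

open CategoryTheory TensorProduct

namespace HKR

/-- étaleness over a symmetric algebra -/
lemma etale_of_bij {R M B : Type} [CommRing R] [AddCommGroup M] [Module R M] [CommRing B]
    [Algebra R B] [Algebra (S R M) B] [IsScalarTower R (S R M) B] [Algebra.FormallySmooth R B]
    (θ : B ⊗[R] M →ₗ[B] Ω[B⁄R])
    (hθ : ∀ m, θ (1 ⊗ₜ m) =
      KaehlerDifferential.D R B (algebraMap (S R M) B (SymmetricAlgebra.ι R M m)))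
    (hb : Function.Bijective θ) : Algebra.FormallyEtale (S R M) B := by
  let g : B ⊗[R] M →ₗ[B] B ⊗[S R M] Ω[S R M⁄R] :=
    LinearMap.liftBaseChange B
      ((TensorProduct.mk (S R M) B Ω[S R M⁄R] 1).restrictScalars R ∘ₗ
        (KaehlerDifferential.D R (S R M)).toLinearMap ∘ₗ SymmetricAlgebra.ι R M)
  have hg : ∀ m, g (1 ⊗ₜ m) = 1 ⊗ₜ KaehlerDifferential.D R (S R M) (SymmetricAlgebra.ι R M m) := by
    intro m; simp [g]
  have hcomp : (KaehlerDifferential.mapBaseChange R (S R M) B) ∘ₗ g = θ := by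
    ext m
    simp [hg, hθ]
  have hgs : Function.Surjective g := by
    rw [← LinearMap.range_eq_top, eq_top_iff]
    rintro x -
    have key : ∀ s : S R M, (1 : B) ⊗ₜ[S R M] KaehlerDifferential.D R (S R M) s ∈ LinearMap.range g := by
      intro s
      induction s using SymmetricAlgebra.induction with
      | algebraMap r => simp
      | ι m => exact ⟨_, hg m⟩
      | add a b ha hb => simp only [map_add, TensorProduct.tmul_add]; exact Submodule.add_mem _ ha hb
      | mul a b ha hb =>
        rw [Derivation.leibniz, TensorProduct.tmul_add, TensorProduct.tmul_smul,
          TensorProduct.tmul_smul, ← algebraMap_smul B a, ← algebraMap_smul B b]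
        exact Submodule.add_mem _ (Submodule.smul_mem _ _ hb) (Submodule.smul_mem _ _ ha)
    induction x with
    | zero => simp
    | add a b ha hb => exact Submodule.add_mem _ ha hb
    | tmul b w =>
      have hw : w ∈ Submodule.span (S R M) (Set.range (KaehlerDifferential.D R (S R M))) := by
        rw [KaehlerDifferential.span_range_derivation]; trivial
      induction hw using Submodule.span_induction with
      | mem x h =>
        obtain ⟨s, rfl⟩ := h
        have := Submodule.smul_mem _ b (key s)
        rwa [TensorProduct.smul_tmul', smul_eq_mul, mul_one] at this
      | zero => simp
      | add x y _ _ hx hy => rw [TensorProduct.tmul_add]; exact Submodule.add_mem _ hx hy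
      | smul a x _ hx =>
        rw [TensorProduct.tmul_smul, ← algebraMap_smul B a]
        exact Submodule.smul_mem _ _ hx
  have hmi : Function.Injective (KaehlerDifferential.mapBaseChange R (S R M) B) := by
    intro x y hxy
    obtain ⟨x, rfl⟩ := hgs x
    obtain ⟨y, rfl⟩ := hgs y
    have := hb.1 (a₁ := x) (a₂ := y) (by rw [← hcomp]; exact hxy)
    rw [this]
  have hms : Function.Surjective (KaehlerDifferential.mapBaseChange R (S R M) B) := by
    intro y
    obtain ⟨x, rfl⟩ := hb.2 y
    exact ⟨g x, by rw [← hcomp]; rfl⟩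
  refine ⟨?_, ?_⟩
  · refine subsingleton_of_forall_eq 0 fun x => ?_
    obtain ⟨y, rfl⟩ := KaehlerDifferential.map_surjective R (S R M) B x
    exact (KaehlerDifferential.exact_mapBaseChange_map R (S R M) B y).2 (hms y)
  · refine subsingleton_of_forall_eq 0 fun x => ?_
    have h1 : Algebra.H1Cotangent.δ R (S R M) B x = 0 := by
      apply hmi
      rw [map_zero]
      exact (Algebra.H1Cotangent.exact_δ_mapBaseChange R (S R M) B _).2 ⟨x, rfl⟩
    obtain ⟨y, rfl⟩ := (Algebra.H1Cotangent.exact_map_δ R (S R M) B x).1 h1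
    rw [Subsingleton.elim y 0, map_zero]

end HKR

open CategoryTheory TensorProduct

namespace HKR

lemma baseChange_surj {A B P W : Type} [CommRing A] [CommRing B] [Algebra A B] [AddCommGroup P] [AddCommGroup W]
    [Module A P] [Module A W] (θ : P →ₗ[A] W) (r : A) (hr : IsUnit (algebraMap A B r))
    (h : ∀ w, r • w ∈ LinearMap.range θ) : Function.Surjective (θ.baseChange B) := by
  rw [← LinearMap.range_eq_top, eq_top_iff]
  rintro x -
  obtain ⟨u, hu⟩ := hr
  induction x with
  | zero => simp
  | add a b ha hb => exact Submodule.add_mem _ ha hb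
  | tmul b w =>
    obtain ⟨p, hp⟩ := h w
    refine ⟨(b * ↑u⁻¹) ⊗ₜ p, ?_⟩
    rw [LinearMap.baseChange_tmul, hp, TensorProduct.tmul_smul, TensorProduct.smul_tmul',
      Algebra.smul_def, ← hu]
    congr 1
    rw [mul_comm, mul_assoc, Units.inv_mul, mul_one]

lemma bij_loc {A P W : Type} [CommRing A] [AddCommGroup P] [AddCommGroup W]
    [Module A P] [Module A W] [Module.Finite A P] [Module.Finite A W] (I : Ideal A)
    (θ : P →ₗ[A] W) (ψ : W →ₗ[A] P)
    (h1 : ∀ p, ψ (θ p) - p ∈ I • (⊤ : Submodule A P))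
    (h2 : ⊤ ≤ LinearMap.range θ ⊔ I • (⊤ : Submodule A W)) :
    ∃ r : A, r - 1 ∈ I ∧ ∀ (B : Type) [CommRing B] [Algebra A B], IsUnit (algebraMap A B r) →
      Function.Bijective (θ.baseChange B) := by
  obtain ⟨r₁, hr₁, hs₁⟩ := Submodule.exists_sub_one_mem_and_smul_le_of_fg_of_le_sup
    (Module.Finite.fg_top) le_rfl h2
  have h3 : ⊤ ≤ LinearMap.range (ψ ∘ₗ θ) ⊔ I • (⊤ : Submodule A P) := by
    intro p _
    have : p = ψ (θ p) - (ψ (θ p) - p) := by abel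
    rw [this]
    exact Submodule.sub_mem _ (Submodule.mem_sup_left ⟨p, rfl⟩) (Submodule.mem_sup_right (h1 p))
  obtain ⟨r₂, hr₂, hs₂⟩ := Submodule.exists_sub_one_mem_and_smul_le_of_fg_of_le_sup
    (Module.Finite.fg_top) le_rfl h3
  refine ⟨r₁ * r₂, ?_, fun B _ _ hB => ?_⟩
  · have : r₁ * r₂ - 1 = (r₁ - 1) * r₂ + (r₂ - 1) := by ring
    rw [this]
    exact I.add_mem (I.mul_mem_right _ hr₁) hr₂
  · rw [map_mul, IsUnit.mul_iff] at hB
    refine ⟨?_, baseChange_surj θ r₁ hB.1 fun w =>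
      hs₁ (Submodule.smul_mem_pointwise_smul _ _ _ trivial)⟩
    have hs := baseChange_surj (B := B) (ψ ∘ₗ θ) r₂ hB.2 fun w =>
      hs₂ (Submodule.smul_mem_pointwise_smul _ _ _ trivial)
    have hi := OrzechProperty.injective_of_surjective_endomorphism _ hs
    rw [LinearMap.baseChange_comp] at hi
    exact Function.Injective.of_comp hi

end HKR

open CategoryTheory TensorProduct

namespace HKR

/-- the localized comparison of cotangent modules -/
lemma nbhd_bij {R M A : Type} [CommRing R] [AddCommGroup M] [Module R M] [CommRing A]
    [Algebra R A] [Module.Finite R M]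
    [Algebra.FormallySmooth R A] [Algebra.FiniteType R A]
    (π : A →ₐ[R] R) (s : M →ₗ[R] A) (hs : ∀ m, π (s m) = 0) (q : A →ₗ[R] M)
    (hq : ∀ a b, q (a * b) = π a • q b + π b • q a) (hqs : ∀ m, q (s m) = m)
    (hI : RingHom.ker π ≤ Ideal.span (Set.range s) ⊔ RingHom.ker π * RingHom.ker π) :
    ∃ r : A, π r = 1 ∧ ∀ (B : Type) [CommRing B] [Algebra A B], IsUnit (algebraMap A B r) →
      Function.Bijective ((LinearMap.liftBaseChange A
        ((KaehlerDifferential.D R A).toLinearMap ∘ₗ s)).baseChange B) := by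
  set θ := LinearMap.liftBaseChange A ((KaehlerDifferential.D R A).toLinearMap ∘ₗ s) with hθd
  have hθ : ∀ a m, θ (a ⊗ₜ m) = a • KaehlerDifferential.D R A (s m) := by
    intro a m; simp [θ]
  let _ : Module A M := Module.compHom M π.toRingHom
  have hsm : ∀ (a : A) (m : M), a • m = π a • m := fun _ _ => rfl
  have : IsScalarTower R A M := ⟨fun r a m => by simp [hsm, mul_smul]⟩
  let dq : Derivation R A M := Derivation.mk' q (by
    intro a b; rw [hq, hsm, hsm])
  let ρ : A ⊗[R] M →ₗ[A] M := LinearMap.liftBaseChange A LinearMap.id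
  have hρ : ∀ a m, ρ (a ⊗ₜ m) = π a • m := by intro a m; simp [ρ, hsm]
  have hρs : Function.Surjective ρ := fun m => ⟨1 ⊗ₜ m, by simp [hρ]⟩
  obtain ⟨ψ, hψ⟩ := Module.projective_lifting_property ρ dq.liftKaehlerDifferential hρs
  have hker : ∀ x : A ⊗[R] M, x - 1 ⊗ₜ ρ x ∈ RingHom.ker π • (⊤ : Submodule A (A ⊗[R] M)) := by
    intro x
    induction x with
    | zero => simp
    | add a b ha hb =>
      rw [map_add, TensorProduct.tmul_add, add_sub_add_comm]
      exact Submodule.add_mem _ ha hb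
    | tmul a m =>
      have : a ⊗ₜ[R] m - 1 ⊗ₜ[R] ρ (a ⊗ₜ m) = (a - algebraMap R A (π a)) • (1 ⊗ₜ[R] m) := by
        rw [hρ, TensorProduct.smul_tmul', smul_eq_mul, mul_one, TensorProduct.sub_tmul,
          Algebra.algebraMap_eq_smul_one, TensorProduct.smul_tmul]
      rw [this]
      exact Submodule.smul_mem_smul (by simp [RingHom.mem_ker]) trivial
  have h1 : ∀ p, ψ (θ p) - p ∈ RingHom.ker π • (⊤ : Submodule A (A ⊗[R] M)) := by
    intro p
    have hρψ : ∀ p, ρ (ψ (θ p)) = ρ p := by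
      intro p
      have : ∀ w, ρ (ψ w) = dq.liftKaehlerDifferential w := fun w => by rw [← hψ]; rfl
      rw [this]
      induction p with
      | zero => simp
      | add a b ha hb => simp only [map_add, ha, hb]
      | tmul a m =>
        rw [hθ, map_smul, Derivation.liftKaehlerDifferential_comp_D, hρ, hsm]
        congr 1
        exact hqs m
    have h := Submodule.sub_mem _ (hker (ψ (θ p))) (hker p)
    rw [hρψ] at h
    simpa using h
  have h2 : ⊤ ≤ LinearMap.range θ ⊔ RingHom.ker π • (⊤ : Submodule A Ω[A⁄R]) := by
    rw [← KaehlerDifferential.span_range_derivation, Submodule.span_le]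
    rintro _ ⟨a, rfl⟩
    have hD : KaehlerDifferential.D R A a = KaehlerDifferential.D R A (a - algebraMap R A (π a)) := by
      simp
    rw [hD]
    have hmem : a - algebraMap R A (π a) ∈ RingHom.ker π := by simp [RingHom.mem_ker]
    generalize a - algebraMap R A (π a) = i at hmem
    obtain ⟨j, hj, l, hl, rfl⟩ := Submodule.mem_sup.1 (hI hmem)
    rw [map_add]
    rw [KaehlerDifferential.span_range_derivation]
    refine Submodule.add_mem _ ?_ ?_
    · clear hmem hD
      induction hj using Submodule.span_induction with
      | mem x h =>
        obtain ⟨m, rfl⟩ := h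
        exact Submodule.mem_sup_left ⟨1 ⊗ₜ m, by simp [hθ]⟩
      | zero => simp
      | add x y _ _ hx hy => rw [map_add]; exact Submodule.add_mem _ hx hy
      | smul a x hx0 hx =>
        rw [smul_eq_mul, Derivation.leibniz]
        refine Submodule.add_mem _ (Submodule.smul_mem _ _ hx)
          (Submodule.mem_sup_right (Submodule.smul_mem_smul ?_ trivial))
        have : Ideal.span (Set.range s) ≤ RingHom.ker π := by
          rw [Ideal.span_le]; rintro _ ⟨m, rfl⟩; exact hs m
        exact this hx0
    · refine Submodule.mem_sup_right ?_
      refine Submodule.mul_induction_on hl ?_ ?_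
      · intro x hx y hy
        rw [Derivation.leibniz]
        exact Submodule.add_mem _ (Submodule.smul_mem_smul hx trivial)
          (Submodule.smul_mem_smul hy trivial)
      · intro x y hx hy
        rw [map_add]; exact Submodule.add_mem _ hx hy
  obtain ⟨r, hr, h⟩ := bij_loc (RingHom.ker π) θ ψ h1 h2
  refine ⟨r, ?_, h⟩
  rw [RingHom.mem_ker, map_sub, map_one, sub_eq_zero] at hr
  exact hr

end HKR

open CategoryTheory TensorProduct

namespace HKR

lemma sym_finiteType (R M : Type) [CommRing R] [AddCommGroup M] [Module R M] [Module.Finite R M] :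
    Algebra.FiniteType R (S R M) := by
  obtain ⟨n, f, hf⟩ := Module.Finite.exists_fin' R M
  let F : MvPolynomial (Fin n) R →ₐ[R] S R M :=
    MvPolynomial.aeval fun i => SymmetricAlgebra.ι R M (f (Pi.single i 1))
  refine Algebra.FiniteType.of_surjective F fun x => ?_
  change x ∈ F.range
  induction x using SymmetricAlgebra.induction with
  | algebraMap r => exact Subalgebra.algebraMap_mem _ r
  | ι m =>
    obtain ⟨v, rfl⟩ := hf m
    rw [pi_eq_sum_univ' v, map_sum, map_sum]
    refine Subalgebra.sum_mem _ fun i _ => ?_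
    rw [map_smul, map_smul]
    have hmem : SymmetricAlgebra.ι R M (f (Pi.single i 1)) ∈ F.range :=
      ⟨MvPolynomial.X i, MvPolynomial.aeval_X _ i⟩
    refine Subalgebra.smul_mem _ ?_ _
    convert! hmem using 3
  | add a b ha hb => exact Subalgebra.add_mem _ ha hb
  | mul a b ha hb => exact Subalgebra.mul_mem _ ha hb

/-- a common étale neighbourhood of the zero section and of the point `π` -/
lemma nbhd {R M A : Type} [CommRing R] [IsNoetherianRing R] [AddCommGroup M] [Module R M] [CommRing A]
    [Algebra R A] [Module.Finite R M]
    [Algebra.FormallySmooth R A] [Algebra.FiniteType R A]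
    (π : A →ₐ[R] R) (s : M →ₗ[R] A) (hs : ∀ m, π (s m) = 0) (q : A →ₗ[R] M)
    (hq : ∀ a b, q (a * b) = π a • q b + π b • q a) (hqs : ∀ m, q (s m) = m)
    (hI : RingHom.ker π ≤ Ideal.span (Set.range s) ⊔ RingHom.ker π * RingHom.ker π) :
    ∃ (B : Type) (_ : CommRing B) (α : A →+* B) (β : S R M →+* B) (p : B →+* R),
      α.Flat ∧ β.Flat ∧ p.comp α = π.toRingHom ∧
      p.comp β = (SymmetricAlgebra.algebraMapInv (R := R) (M := M)).toRingHom ∧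
      α.comp (algebraMap R A) = β.comp (algebraMap R (S R M)) ∧
      RingHom.ker p ≤ Ideal.map α (RingHom.ker π.toRingHom) ∧
      RingHom.ker p ≤ Ideal.map β
        (RingHom.ker (SymmetricAlgebra.algebraMapInv (R := R) (M := M)).toRingHom) := by
  obtain ⟨r, hr, hbij⟩ := nbhd_bij π s hs q hq hqs hI
  have : IsNoetherianRing A := Algebra.FiniteType.isNoetherianRing R A
  obtain ⟨r₁, hr₁, hle⟩ := Submodule.exists_sub_one_mem_and_smul_le_of_fg_of_le_sup
    (I := RingHom.ker π) (N := Ideal.span (Set.range s)) (N' := RingHom.ker π) (P := RingHom.ker π)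
    (IsNoetherian.noetherian _) le_rfl hI
  have hr₁' : π r₁ = 1 := by
    rw [RingHom.mem_ker, map_sub, map_one, sub_eq_zero] at hr₁
    exact hr₁
  let B := Localization.Away (r * r₁)
  let Φ : S R M →ₐ[R] A := SymmetricAlgebra.lift s
  have hΦ : ∀ m, Φ (SymmetricAlgebra.ι R M m) = s m := fun m => SymmetricAlgebra.lift_ι_apply s m
  let β : S R M →+* B := (algebraMap A B).comp Φ.toRingHom
  let _ : Algebra (S R M) B := β.toAlgebra
  have hβ : ∀ x, algebraMap (S R M) B x = algebraMap A B (Φ x) := fun x => rfl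
  have htow : IsScalarTower R (S R M) B := IsScalarTower.of_algebraMap_eq fun x => by
    rw [hβ, AlgHom.commutes, ← IsScalarTower.algebraMap_apply]
  have hu : IsUnit (algebraMap A B (r * r₁)) := IsLocalization.Away.algebraMap_isUnit _
  have hu' := hu
  rw [map_mul, IsUnit.mul_iff] at hu'
  have hb := hbij B hu'.1
  have : Algebra.FormallyEtale A B := Algebra.FormallyEtale.of_isLocalization (Submonoid.powers (r * r₁))
  have het : Algebra.FormallyEtale (S R M) B := by
    refine etale_of_bij ((KaehlerDifferential.tensorKaehlerEquivOfFormallyEtale R A B).toLinearMap ∘ₗ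
      (LinearMap.liftBaseChange A
        ((KaehlerDifferential.D R A).toLinearMap ∘ₗ s)).baseChange B ∘ₗ
      (TensorProduct.AlgebraTensorModule.cancelBaseChange R A B B M).symm.toLinearMap) ?_ ?_
    · intro m
      simp [hβ, hΦ]
    · exact (KaehlerDifferential.tensorKaehlerEquivOfFormallyEtale R A B).bijective.comp (hb.comp
        (TensorProduct.AlgebraTensorModule.cancelBaseChange R A B B M).symm.bijective)
  have := sym_finiteType R M
  have : IsNoetherianRing (S R M) := Algebra.FiniteType.isNoetherianRing R (S R M)
  have : Algebra.FiniteType A B := IsLocalization.finiteType_of_monoid_fg (Submonoid.powers (r * r₁)) B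
  have : Algebra.FiniteType R B := Algebra.FiniteType.trans (S := A) ‹_› ‹_›
  have : Algebra.FiniteType (S R M) B := Algebra.FiniteType.of_restrictScalars_finiteType R _ _
  have : Algebra.FinitePresentation (S R M) B := Algebra.FinitePresentation.of_finiteType.1 this
  have hsm : Algebra.Smooth (S R M) B := {}
  have hfl : Module.Flat (S R M) B := inferInstance
  let p : B →+* R := IsLocalization.Away.lift (r * r₁) (g := π.toRingHom) (by
    change IsUnit (π (r * r₁))
    rw [map_mul, hr, hr₁', mul_one]; exact isUnit_one)
  have hp : ∀ a, p (algebraMap A B a) = π a := fun a => IsLocalization.Away.lift_eq _ _ a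
  have hk1 : RingHom.ker p ≤ Ideal.map (algebraMap A B) (RingHom.ker π.toRingHom) := by
    intro b hb
    obtain ⟨n, a, hna⟩ := IsLocalization.Away.surj (r * r₁) b
    have : π a = 0 := by
      rw [← hp, ← hna, map_mul, RingHom.mem_ker.1 hb, zero_mul]
    have h1 : algebraMap A B a ∈ Ideal.map (algebraMap A B) (RingHom.ker π.toRingHom) :=
      Ideal.mem_map_of_mem _ this
    rw [← hna] at h1
    exact (Ideal.mul_unit_mem_iff_mem _ (hu.pow n)).1 h1
  refine ⟨B, inferInstance, algebraMap A B, β, p, ?_, ?_, ?_, ?_, ?_, hk1, ?_⟩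
  · rw [RingHom.flat_algebraMap_iff]; exact IsLocalization.flat B (Submonoid.powers (r * r₁))
  · exact hfl
  · ext a; exact hp a
  · have : (π.comp Φ) = SymmetricAlgebra.algebraMapInv := by
      ext m
      exact (congrArg π (hΦ m)).trans ((hs m).trans (SymmetricAlgebra.algebraMapInv_ι m).symm)
    ext x
    change p (algebraMap A B (Φ x)) = _
    rw [hp, ← this]; rfl
  · ext x
    change _ = algebraMap (S R M) B _
    rw [RingHom.comp_apply, ← IsScalarTower.algebraMap_apply, ← IsScalarTower.algebraMap_apply]
  · refine hk1.trans ?_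
    rw [Ideal.map_le_iff_le_comap]
    intro a ha
    rw [Ideal.mem_comap]
    have h1 : r₁ * a ∈ Ideal.span (Set.range s) :=
      hle (Submodule.smul_mem_pointwise_smul a r₁ _ ha)
    have h2 : Ideal.span (Set.range s) ≤ Ideal.comap (algebraMap A B) (Ideal.map β
        (RingHom.ker (SymmetricAlgebra.algebraMapInv (R := R) (M := M)).toRingHom)) := by
      rw [Ideal.span_le]
      rintro _ ⟨m, rfl⟩
      rw [SetLike.mem_coe, Ideal.mem_comap]
      rw [← hΦ]
      exact Ideal.mem_map_of_mem β (x := SymmetricAlgebra.ι R M m)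
        (SymmetricAlgebra.algebraMapInv_ι m)
    have h3 := h2 h1
    rw [Ideal.mem_comap, map_mul] at h3
    exact (Ideal.unit_mul_mem_iff_mem _ hu'.2).1 h3

end HKR

open CategoryTheory TensorProduct

namespace HKR


lemma hkr_nbhd (k R : Type) [Field k] [CommRing R] [Algebra k R]
    [Algebra.FormallySmooth k R] [Algebra.FiniteType k R] :
    ∃ (B : Type) (_ : CommRing B) (α : R ⊗[k] R →+* B) (β : S R Ω[R⁄k] →+* B) (p : B →+* R),
      α.Flat ∧ β.Flat ∧ p.comp α = (Algebra.TensorProduct.lmul' k (S := R)).toRingHom ∧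
      p.comp β = (SymmetricAlgebra.algebraMapInv (R := R) (M := Ω[R⁄k])).toRingHom ∧
      α.comp (algebraMap R (R ⊗[k] R)) = β.comp (algebraMap R (S R Ω[R⁄k])) ∧
      RingHom.ker p ≤ Ideal.map α
        (RingHom.ker (Algebra.TensorProduct.lmul' k (S := R)).toRingHom) ∧
      RingHom.ker p ≤ Ideal.map β
        (RingHom.ker (SymmetricAlgebra.algebraMapInv (R := R) (M := Ω[R⁄k])).toRingHom) := by
  have : IsNoetherianRing R := Algebra.FiniteType.isNoetherianRing k R
  let π : R ⊗[k] R →ₐ[R] R := Algebra.TensorProduct.lmul'' k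
  have hπ : ∀ x, π x = Algebra.TensorProduct.lmul' k x := fun _ => rfl
  obtain ⟨s, hs⟩ := Module.projective_lifting_property
    ((KaehlerDifferential.fromIdeal k R).restrictScalars R) LinearMap.id
    (KaehlerDifferential.fromIdeal_surjective k R)
  have hs' : ∀ m, KaehlerDifferential.fromIdeal k R (s m) = m := fun m => DFunLike.congr_fun hs m
  exact nbhd (R := R) (A := R ⊗[k] R) (M := Ω[R⁄k]) π
    (((KaehlerDifferential.ideal k R).subtype.restrictScalars R) ∘ₗ s)
    (fun m => (s m).2) (KaehlerDifferential.D k R).tensorProductTo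
    (fun a b => Derivation.tensorProductTo_mul _ a b)
    (fun m => (KaehlerDifferential.D_tensorProductTo (s m)).trans (hs' m))
    (fun i hi => by
      let i' : KaehlerDifferential.ideal k R := ⟨i, hi⟩
      have h1 : KaehlerDifferential.fromIdeal k R (i' - s (KaehlerDifferential.fromIdeal k R i')) = 0 := by
        rw [map_sub, hs', sub_self]
      have h2 : (i' - s (KaehlerDifferential.fromIdeal k R i') : KaehlerDifferential.ideal k R).1 ∈
          (KaehlerDifferential.ideal k R) ^ 2 :=
        (Ideal.toCotangent_eq_zero _ _).1 h1
      rw [pow_two] at h2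
      have h3 : i = (s (KaehlerDifferential.fromIdeal k R i')).1 +
          (i' - s (KaehlerDifferential.fromIdeal k R i') : KaehlerDifferential.ideal k R).1 := by
        simp [i']
      rw [h3]
      exact Submodule.add_mem _ (Submodule.mem_sup_left (Ideal.subset_span ⟨_, rfl⟩))
        (Submodule.mem_sup_right h2))

end HKR

open CategoryTheory TensorProduct

namespace HKR
open ModuleCat

/-- base change of the residue module along a neighbourhood -/
lemma extend_iso {A B R : Type} [CommRing A] [CommRing B] [CommRing R] (α : A →+* B) (p : B →+* R)
    (π : A →+* R) (hπ : p.comp α = π) (hs : Function.Surjective π)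
    (hk : RingHom.ker p ≤ Ideal.map α (RingHom.ker π)) :
    Nonempty ((extendScalars α).obj ((restrictScalars π).obj (ModuleCat.of R R)) ≅
      (restrictScalars p).obj (ModuleCat.of R R)) := by
  subst hπ
  let _ : Algebra A B := α.toAlgebra
  let _ : Algebra A R := (p.comp α).toAlgebra
  let _ : Algebra B R := p.toAlgebra
  have : IsScalarTower A B R := IsScalarTower.of_algebraMap_eq fun _ => rfl
  let F : B ⊗[A] R →ₗ[B] R := LinearMap.liftBaseChange B LinearMap.id
  have hF : ∀ b r, F (b ⊗ₜ r) = p b * r := fun b r => by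
    simp only [F, LinearMap.liftBaseChange_tmul, LinearMap.id_apply]; rfl
  have hone : ∀ x : B ⊗[A] R, ∃ b, x = b ⊗ₜ 1 := by
    intro x
    induction x with
    | zero => exact ⟨0, by simp⟩
    | add x y hx hy =>
      obtain ⟨a, rfl⟩ := hx
      obtain ⟨b, rfl⟩ := hy
      exact ⟨a + b, by rw [TensorProduct.add_tmul]⟩
    | tmul b r =>
      obtain ⟨a, rfl⟩ := hs r
      refine ⟨a • b, ?_⟩
      rw [TensorProduct.smul_tmul, Algebra.smul_def, mul_one]; rfl
  have hz : ∀ b : B, b ∈ Ideal.map α (RingHom.ker (p.comp α)) → b ⊗ₜ[A] (1 : R) = 0 := by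
    intro b hb
    induction hb using Submodule.span_induction with
    | mem x h =>
      obtain ⟨a, ha, rfl⟩ := h
      have h1 : α a = a • (1 : B) := by rw [Algebra.smul_def, mul_one]; rfl
      have h2 : a • (1 : R) = 0 := by rw [Algebra.smul_def, mul_one]; exact ha
      rw [h1, TensorProduct.smul_tmul, h2, TensorProduct.tmul_zero]
    | zero => simp
    | add x y _ _ hx hy => rw [TensorProduct.add_tmul, hx, hy, add_zero]
    | smul a x _ hx => rw [← TensorProduct.smul_tmul', hx, smul_zero]
  have hbij : Function.Bijective F := by
    constructor
    · rw [injective_iff_map_eq_zero]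
      intro x hx
      obtain ⟨b, rfl⟩ := hone x
      rw [hF, mul_one] at hx
      exact hz b (hk hx)
    · intro r
      exact ⟨1 ⊗ₜ r, by rw [hF]; simp⟩
  exact ⟨(LinearEquiv.ofBijective F hbij).toModuleIso⟩

/-- transport of `Ext` along a common flat neighbourhood -/
lemma ext_compare {A T B R : Type} [CommRing A] [CommRing T] [CommRing B] [CommRing R]
    (α : A →+* B) (β : T →+* B) (p : B →+* R)
    (π : A →+* R) (ε : T →+* R) (hα : α.Flat) (hβ : β.Flat) (hπ : p.comp α = π) (hε : p.comp β = ε)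
    (hsπ : Function.Surjective π) (hsε : Function.Surjective ε)
    (hkπ : RingHom.ker p ≤ Ideal.map α (RingHom.ker π))
    (hkε : RingHom.ker p ≤ Ideal.map β (RingHom.ker ε)) (n : ℕ) :
    ∃ X : ModuleCat.{0} B,
      Nonempty ((restrictScalars α).obj X ≅
        ((Ext A (ModuleCat A) n).obj (Opposite.op ((restrictScalars π).obj (ModuleCat.of R R)))).obj
          ((restrictScalars π).obj (ModuleCat.of R R))) ∧
      Nonempty ((restrictScalars β).obj X ≅
        ((Ext T (ModuleCat T) n).obj (Opposite.op ((restrictScalars ε).obj (ModuleCat.of R R)))).obj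
          ((restrictScalars ε).obj (ModuleCat.of R R))) := by
  let N := (restrictScalars p).obj (ModuleCat.of R R)
  refine ⟨((Ext B (ModuleCat B) n).obj (Opposite.op N)).obj N, ?_, ?_⟩
  · obtain ⟨e⟩ := extend_iso α p π hπ hsπ hkπ
    obtain ⟨e'⟩ := ext_change α hα ((restrictScalars π).obj (ModuleCat.of R R)) N n
    subst hπ
    exact ⟨(restrictScalars α).mapIso (((Ext B (ModuleCat B) n).mapIso e.op).app N) ≪≫ e'⟩
  · obtain ⟨e⟩ := extend_iso β p ε hε hsε hkε
    obtain ⟨e'⟩ := ext_change β hβ ((restrictScalars ε).obj (ModuleCat.of R R)) N n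
    subst hε
    exact ⟨(restrictScalars β).mapIso (((Ext B (ModuleCat B) n).mapIso e.op).app N) ≪≫ e'⟩

end HKR

open CategoryTheory TensorProduct

namespace HKR

lemma pairing_nat {R M N : Type} [CommRing R] [AddCommGroup M] [Module R M] [AddCommGroup N] [Module R N]
    (f : M →ₗ[R] N) (n : ℕ) (x : ⋀[R]^n (Module.Dual R N)) :
    exteriorPower.pairingDual R M n (exteriorPower.map n f.dualMap x) =
      (exteriorPower.map n f).dualMap (exteriorPower.pairingDual R N n x) := by
  have : exteriorPower.pairingDual R M n ∘ₗ exteriorPower.map n f.dualMap =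
      (exteriorPower.map n f).dualMap ∘ₗ exteriorPower.pairingDual R N n := by
    ext φ v
    simp
  exact DFunLike.congr_fun this x

lemma pairing_free {R : Type} [CommRing R] (m n : ℕ) :
    Function.Bijective (exteriorPower.pairingDual R (Fin m → R) n) := by
  classical
  let b := Pi.basisFun R (Fin m)
  let e := (b.dualBasis.exteriorPower n).equiv ((b.exteriorPower n).dualBasis) (Equiv.refl _)
  have : exteriorPower.pairingDual R (Fin m → R) n = e.toLinearMap := by
    refine (b.dualBasis.exteriorPower n).ext fun s => ?_
    rw [LinearEquiv.coe_coe, Module.Basis.equiv_apply, Equiv.refl_apply, Module.Basis.coe_dualBasis,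
      exteriorPower.basis_coord, exteriorPower.basis_apply, Module.Basis.coe_dualBasis]
    rfl
  rw [this]
  exact e.bijective

lemma pairing_bij {R M : Type} [CommRing R] [AddCommGroup M] [Module R M]
    [Module.Finite R M] [Module.Projective R M] (n : ℕ) :
    Function.Bijective (exteriorPower.pairingDual R M n) := by
  obtain ⟨m, f, hf⟩ := Module.Finite.exists_fin' R M
  obtain ⟨g, hg⟩ := Module.projective_lifting_property f LinearMap.id hf
  have hF := pairing_free (R := R) m n
  have h1 : ∀ x, exteriorPower.map n g.dualMap (exteriorPower.map n f.dualMap x) = x := by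
    intro x
    rw [← LinearMap.comp_apply, ← exteriorPower.map_comp, LinearMap.dualMap_comp_dualMap, hg]
    simp
  have h2 : ∀ y, (exteriorPower.map n g).dualMap ((exteriorPower.map n f).dualMap y) = y := by
    intro y
    rw [← LinearMap.comp_apply, LinearMap.dualMap_comp_dualMap, ← exteriorPower.map_comp, hg]
    simp
  constructor
  · rw [injective_iff_map_eq_zero]
    intro x hx
    have := pairing_nat f n x
    rw [hx, map_zero] at this
    rw [← h1 x, (injective_iff_map_eq_zero _).1 hF.1 _ this, map_zero]
  · intro y
    obtain ⟨z, hz⟩ := hF.2 ((exteriorPower.map n f).dualMap y)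
    exact ⟨exteriorPower.map n g.dualMap z, by rw [pairing_nat, hz, h2]⟩

lemma ext_der (k R : Type) [Field k] [CommRing R] [Algebra k R]
    [Algebra.FormallySmooth k R] [Algebra.FiniteType k R] (n : ℕ) :
    Nonempty ((⋀[R]^n Ω[R⁄k] →ₗ[R] R) ≃ₗ[R] ⋀[R]^n (Derivation k R R)) := by
  let e := KaehlerDifferential.linearMapEquivDerivation k R (M := R)
  let e' : ⋀[R]^n (Module.Dual R Ω[R⁄k]) ≃ₗ[R] ⋀[R]^n (Derivation k R R) :=
    LinearEquiv.ofLinearMap (exteriorPower.map n e.toLinearMap) (exteriorPower.map n e.symm.toLinearMap)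
      (by rw [← exteriorPower.map_comp]; simp) (by rw [← exteriorPower.map_comp]; simp)
  exact ⟨(LinearEquiv.ofBijective _ (pairing_bij (R := R) (M := Ω[R⁄k]) n)).symm ≪≫ₗ e'⟩

lemma nonempty_equiv {k M N : Type} [Semiring k] [AddCommMonoid M] [AddCommMonoid N]
    (m₁ : Module k M) (m₂ : Module k N) (E : M ≃+ N) (h : ∀ (c : k) (x : M), E (c • x) = c • E x) :
    Nonempty (M ≃ₗ[k] N) := ⟨E.toLinearEquiv h⟩

end HKR

open CategoryTheory TensorProduct

/-- **Hochschild–Kostant–Rosenberg theorem, affine cohomological case.**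
Let `k` be a field of characteristic zero and `R` a smooth commutative `k`-algebra
(formally smooth and of finite type over `k`), regarded as a module over the enveloping
algebra `R ⊗[k] R` via the multiplication map.  Then for every `i ≥ 0` there is an
isomorphism of `k`-modules
`Ext^i_{R⊗R}(R, R) ≅ ⋀ᵢ_R Der_k(R, R)`,
where `Der_k(R, R)` is the `R`-module of `k`-linear derivations of `R`, and the
`k`-module structures are obtained by restriction of scalars. -/
theorem hkr_affine_cohomology (k : Type) [Field k] [CharZero k]
    (R : Type) [CommRing R] [Algebra k R]
    [Algebra.FormallySmooth k R] [Algebra.FiniteType k R] (i : ℕ) :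
    letI : Module (R ⊗[k] R) R :=
      Module.compHom R (Algebra.TensorProduct.lmul' k (S := R)).toRingHom
    letI : Module k
        (((Ext (R ⊗[k] R) (ModuleCat (R ⊗[k] R)) i).obj
            (Opposite.op (ModuleCat.of (R ⊗[k] R) R))).obj
          (ModuleCat.of (R ⊗[k] R) R)) :=
      Module.compHom _ (algebraMap k (R ⊗[k] R))
    letI : Module k (⋀[R]^i (Derivation k R R)) :=
      Module.compHom _ (algebraMap k R)
    Nonempty
      ((((Ext (R ⊗[k] R) (ModuleCat (R ⊗[k] R)) i).obj
            (Opposite.op (ModuleCat.of (R ⊗[k] R) R))).obj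
          (ModuleCat.of (R ⊗[k] R) R)) ≃ₗ[k] ⋀[R]^i (Derivation k R R)) := by
  let _ : Algebra ℚ R := ((algebraMap k R).comp (algebraMap ℚ k)).toAlgebra
  obtain ⟨B, _, α, β, p, hα, hβ, hπ, hε, hcomp, hk1, hk2⟩ := HKR.hkr_nbhd k R
  obtain ⟨X, ⟨e1⟩, ⟨e2⟩⟩ := HKR.ext_compare α β p _ _ hα hβ hπ hε
    (fun r => ⟨r ⊗ₜ 1, by
      change Algebra.TensorProduct.lmul' k (r ⊗ₜ[k] (1 : R)) = r
      simp⟩)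
    (fun r => ⟨algebraMap R _ r, AlgHom.commutes _ r⟩) hk1 hk2 i
  obtain ⟨e3⟩ := HKR.koszul_ext (R := R) (M := Ω[R⁄k]) i
  obtain ⟨e4⟩ := HKR.ext_der k R i
  let f1 := e1.symm.toLinearEquiv
  let f2 := (e2 ≪≫ e3).toLinearEquiv
  let g1 : (((Ext (R ⊗[k] R) (ModuleCat (R ⊗[k] R)) i).obj
            (Opposite.op ((ModuleCat.restrictScalars
              (Algebra.TensorProduct.lmul' k (S := R)).toRingHom).obj (ModuleCat.of R R)))).obj
          ((ModuleCat.restrictScalars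
              (Algebra.TensorProduct.lmul' k (S := R)).toRingHom).obj (ModuleCat.of R R))) ≃+ X :=
    f1.toAddEquiv
  let g2 : X ≃+ (⋀[R]^i Ω[R⁄k] →ₗ[R] R) := f2.toAddEquiv
  refine HKR.nonempty_equiv _ _ (g1.trans (g2.trans e4.toAddEquiv)) ?_
  · intro c x
    have h1 : g1 (algebraMap k (R ⊗[k] R) c • x) = α (algebraMap k (R ⊗[k] R) c) • g1 x :=
      map_smul f1 _ x
    have hc : α (algebraMap k (R ⊗[k] R) c) = β (algebraMap R _ (algebraMap k R c)) := by
      rw [IsScalarTower.algebraMap_apply k R (R ⊗[k] R)]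
      exact DFunLike.congr_fun hcomp _
    have h2 : ∀ (r : R) (u : X), g2 (β (algebraMap R _ r) • u) = r • g2 u := by
      intro r u
      have h := map_smul f2 (algebraMap R (HKR.S R Ω[R⁄k]) r)
        (show (ModuleCat.restrictScalars β).obj X from u)
      refine h.trans ?_
      change (SymmetricAlgebra.algebraMapInv (algebraMap R (HKR.S R Ω[R⁄k]) r) : R) • g2 u = _
      rw [AlgHom.commutes]; rfl
    change e4 (g2 (g1 (algebraMap k (R ⊗[k] R) c • x))) = algebraMap k R c • e4 (g2 (g1 x))
    rw [h1, hc, h2]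
    exact map_smul e4 _ _
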